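/- arXiv:2409.10731 — 6 statements merged into one kernel-verified Lean document; each statement's English description precedes it below -/
import Mathlib

section
/- Let X be a spectral topological space, Y any topological space, and φ : X → Y a continuous surjective map. Suppose that for every closed subset Z of X whose complement is quasi-compact there exists a closed subset S of Y with φ⁻¹(S) = Z. Then φ is a homeomorphism (it is an open, continuous bijection). -/
open TopologicalSpace

/-- Let `X` be a spectral topological space, `Y` any topological space, and
`φ : X → Y` a continuous surjective map. Suppose that for every closed subset `Z` of `X`
whose complement is quasi-compact there exists a closed subset `S` of `Y` with
`φ ⁻¹' S = Z`. Then `φ` is a homeomorphism (an open, continuous bijection). -/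
theorem stmt1 {X Y : Type*} [TopologicalSpace X] [TopologicalSpace Y]
    (hX_compact : CompactSpace X) (hX_T0 : T0Space X)
    (hX_basis : IsTopologicalBasis {U : Set X | IsOpen U ∧ IsCompact U})
    (hX_inter : ∀ U V : Set X, IsOpen U → IsCompact U → IsOpen V → IsCompact V →
      IsCompact (U ∩ V))
    (hX_sober : ∀ Z : Set X, IsIrreducible Z → IsClosed Z → ∃! x : X, closure {x} = Z)
    (φ : X → Y) (hφ : Continuous φ) (hsurj : Function.Surjective φ)
    (hsupp : ∀ Z : Set X, IsClosed Z → IsCompact Zᶜ →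
      ∃ S : Set Y, IsClosed S ∧ φ ⁻¹' S = Z) :
    IsHomeomorph φ := by
  have key : ∀ U : Set X, IsOpen U → IsCompact U → ∃ V : Set Y, IsOpen V ∧ φ ⁻¹' V = U := by
    intro U hU hUc
    obtain ⟨S, hS, hSU⟩ := hsupp Uᶜ hU.isClosed_compl (by rwa [compl_compl])
    exact ⟨Sᶜ, hS.isOpen_compl, by rw [Set.preimage_compl, hSU, compl_compl]⟩
  refine ⟨hφ, ?_, ?_, hsurj⟩
  · rw [hX_basis.isOpenMap_iff]
    rintro U ⟨hU, hUc⟩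
    obtain ⟨V, hV, rfl⟩ := key U hU hUc
    rwa [Set.image_preimage_eq V hsurj]
  · intro x y hxy
    apply Inseparable.eq
    rw [hX_basis.inseparable_iff]
    rintro U ⟨hU, hUc⟩
    obtain ⟨V, hV, rfl⟩ := key U hU hUc
    simp only [Set.mem_preimage, hxy]
end

section
/- For every ideal I of A there exists a smallest invariant ideal containing I: an invariant ideal I♯ of A with I ⊆ I♯ such that I♯ ⊆ J for every invariant ideal J of A with I ⊆ J. -/
open TensorProduct

variable (k : Type*) [Field k]
variable (A : Type*) [CommRing A] [Algebra k A]
variable (H : Type*) [Ring H] [HopfAlgebra k H]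

/-- The image `I ⊗ H` of the canonical map `I ⊗[k] H → A ⊗[k] H`, for an ideal `I` of `A`. -/
noncomputable def idealTensor (I : Ideal A) : Submodule k (A ⊗[k] H) :=
  LinearMap.range (TensorProduct.map ((I.restrictScalars k).subtype)
    (LinearMap.id : H →ₗ[k] H))

/-- An ideal `I` of `A` is invariant (for the coaction `ψ : A → A ⊗[k] H`) if
`ψ x ∈ I ⊗ H` for all `x ∈ I`. -/
def IsInvariantIdeal (ψ : A →ₐ[k] A ⊗[k] H) (I : Ideal A) : Prop :=
  ∀ x ∈ I, ψ x ∈ idealTensor k A H I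

/-- Coassociativity of the coaction `ψ`:
`(ψ ⊗ id_H) ∘ ψ = (id_A ⊗ Δ_H) ∘ ψ` as maps `A → A ⊗[k] H ⊗[k] H`. -/
def IsCoassoc (ψ : A →ₐ[k] A ⊗[k] H) : Prop :=
  ∀ a : A,
    (TensorProduct.assoc k A H H)
        ((TensorProduct.map ψ.toLinearMap (LinearMap.id : H →ₗ[k] H)) (ψ a))
      = (TensorProduct.map (LinearMap.id : A →ₗ[k] A)
          (Coalgebra.comul (R := k) (A := H))) (ψ a)

/-- Counitality of the coaction `ψ`: `(id_A ⊗ ε_H) ∘ ψ = id_A` under the canonical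
isomorphism `A ⊗[k] k ≅ A`. -/
def IsCounital (ψ : A →ₐ[k] A ⊗[k] H) : Prop :=
  ∀ a : A,
    (TensorProduct.rid k A)
        ((TensorProduct.map (LinearMap.id : A →ₗ[k] A)
          (Coalgebra.counit (R := k) (A := H))) (ψ a)) = a

/-- The set `I* = {x ∈ I : ψ x ∈ I ⊗ H}`. -/
def starSet (ψ : A →ₐ[k] A ⊗[k] H) (I : Ideal A) : Set A :=
  {x : A | x ∈ I ∧ ψ x ∈ idealTensor k A H I}

theorem mem_idealTensor_iff_basis {ι : Type*} [DecidableEq ι] (b : Module.Basis ι k H) (I : Ideal A)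
    (y : A ⊗[k] H) :
    y ∈ idealTensor k A H I ↔ ∀ i, TensorProduct.equivFinsuppOfBasisRight b y i ∈ I := by
  constructor
  · rintro ⟨z, rfl⟩ i
    induction z using TensorProduct.induction_on with
    | zero => simp
    | tmul x h =>
      simp only [TensorProduct.map_tmul, TensorProduct.equivFinsuppOfBasisRight_apply_tmul_apply]
      exact (I.restrictScalars k).smul_mem _ x.2
    | add u v hu hv =>
      simp only [map_add, Finsupp.add_apply]
      exact I.add_mem hu hv
  · intro h
    rw [← (TensorProduct.equivFinsuppOfBasisRight b).symm_apply_apply y,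
      TensorProduct.equivFinsuppOfBasisRight_symm_apply]
    refine Submodule.sum_mem _ fun i _ => ?_
    exact ⟨(⟨_, h i⟩ : I.restrictScalars k) ⊗ₜ[k] b i, by simp⟩

/-- for every ideal `I` of `A` there is a smallest invariant ideal `I♯`
containing `I`. -/
theorem stmt3 (ψ : A →ₐ[k] A ⊗[k] H)
    (hco : IsCoassoc k A H ψ) (hcu : IsCounital k A H ψ) (I : Ideal A) :
    ∃ Isharp : Ideal A, IsInvariantIdeal k A H ψ Isharp ∧ I ≤ Isharp ∧
      ∀ J : Ideal A, IsInvariantIdeal k A H ψ J → I ≤ J → Isharp ≤ J := by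
  classical
  refine ⟨sInf {J | IsInvariantIdeal k A H ψ J ∧ I ≤ J}, ?_, ?_, ?_⟩
  · intro x hx
    rw [mem_idealTensor_iff_basis k A H (Module.Basis.ofVectorSpace k H)]
    intro i
    rw [Submodule.mem_sInf] at hx ⊢
    intro J hJ
    exact (mem_idealTensor_iff_basis k A H _ J _).1 (hJ.1 x (hx J hJ)) i
  · exact le_sInf fun J hJ => hJ.2
  · exact fun J h1 h2 => sInf_le ⟨h1, h2⟩
end

section
/- Assume that for every prime ideal p of A, the largest invariant ideal p* = {x ∈ p : ψ(x) ∈ p ⊗ H} contained in p is again a prime ideal. Then for every invariant ideal I of A, the radical √I equals the intersection of all invariant prime ideals of A containing I; in particular, √I is an invariant ideal. -/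
open TensorProduct

variable (k : Type*) [Field k]
variable (A : Type*) [CommRing A] [Algebra k A]
variable (H : Type*) [Ring H] [HopfAlgebra k H]

/-- `id ⊗ φ` as a map `A ⊗ H → A`. -/
noncomputable def slice (φ : H →ₗ[k] k) : A ⊗[k] H →ₗ[k] A :=
  (TensorProduct.rid k A).toLinearMap ∘ₗ TensorProduct.map LinearMap.id φ

theorem slice_tmul (φ : H →ₗ[k] k) (a : A) (h : H) :
    slice k A H φ (a ⊗ₜ[k] h) = φ h • a := by
  simp [slice]

theorem mem_idealTensor_iff (J : Ideal A) (z : A ⊗[k] H) :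
    z ∈ idealTensor k A H J ↔ ∀ φ : H →ₗ[k] k, slice k A H φ z ∈ J := by
  constructor
  · rintro ⟨w, rfl⟩ φ
    induction w using TensorProduct.induction_on with
    | zero => simp
    | tmul x h =>
      rw [TensorProduct.map_tmul, slice_tmul]
      exact (J.restrictScalars k).smul_mem _ x.2
    | add x y hx hy =>
      rw [map_add, map_add]
      exact J.add_mem hx hy
  · intro hz
    let b := Module.Basis.ofVectorSpace k H
    obtain ⟨c, rfl⟩ := TensorProduct.eq_repr_basis_right b z
    refine Submodule.sum_mem _ fun i _ => ?_
    have h := hz (b.coord i)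
    have e : slice k A H (b.coord i) (c.sum fun i m => m ⊗ₜ[k] b i) = c i := by
      classical
      rw [Finsupp.sum, map_sum]
      simp only [slice_tmul, Module.Basis.coord_apply, Module.Basis.repr_self,
        Finsupp.single_apply, ite_smul, one_smul, zero_smul]
      simp
      exact fun h => h.symm
    rw [e] at h
    exact ⟨(⟨c i, h⟩ : J.restrictScalars k) ⊗ₜ[k] b i, by simp⟩

theorem slice_slice (ψ : A →ₐ[k] A ⊗[k] H) (hco : IsCoassoc k A H ψ)
    (φ χ : H →ₗ[k] k) (x : A) :
    slice k A H χ (ψ (slice k A H φ (ψ x))) =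
      slice k A H ((TensorProduct.lid k k).toLinearMap ∘ₗ TensorProduct.map χ φ ∘ₗ
        Coalgebra.comul) (ψ x) := by
  let T : A ⊗[k] (H ⊗[k] H) →ₗ[k] A := (TensorProduct.rid k A).toLinearMap ∘ₗ
    TensorProduct.map LinearMap.id ((TensorProduct.lid k k).toLinearMap ∘ₗ TensorProduct.map χ φ)
  have h1 : ∀ z : A ⊗[k] H, slice k A H χ (ψ (slice k A H φ z)) =
      T ((TensorProduct.assoc k A H H)
        ((TensorProduct.map ψ.toLinearMap (LinearMap.id : H →ₗ[k] H)) z)) := by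
    intro z
    induction z using TensorProduct.induction_on with
    | zero => simp
    | add x y hx hy => simp only [map_add, hx, hy]
    | tmul a h =>
      rw [slice_tmul, map_smul, map_smul, TensorProduct.map_tmul, AlgHom.toLinearMap_apply]
      generalize ψ a = w
      induction w using TensorProduct.induction_on with
      | zero => simp
      | add x y hx hy => simp only [map_add, smul_add, hx, hy, TensorProduct.add_tmul]
      | tmul a' h' => simp [T, slice_tmul, smul_smul, mul_comm]
  have h2 : ∀ z : A ⊗[k] H, T (TensorProduct.map (LinearMap.id : A →ₗ[k] A)
      (Coalgebra.comul (R := k) (A := H)) z) =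
      slice k A H ((TensorProduct.lid k k).toLinearMap ∘ₗ TensorProduct.map χ φ ∘ₗ
        Coalgebra.comul) z := by
    intro z
    induction z using TensorProduct.induction_on with
    | zero => simp
    | add x y hx hy => simp only [map_add, hx, hy]
    | tmul a h => simp [T, slice_tmul]
  rw [h1, hco, h2]

/-- if `p*` is prime for every prime `p`, then for every invariant ideal
`I` the radical `√I` is the intersection of all invariant prime ideals containing `I`;
in particular `√I` is invariant. -/
theorem stmt8 (ψ : A →ₐ[k] A ⊗[k] H)
    (hco : IsCoassoc k A H ψ) (hcu : IsCounital k A H ψ)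
    (hstar : ∀ p : Ideal A, p.IsPrime →
      ∃ q : Ideal A, (q : Set A) = starSet k A H ψ p ∧ q.IsPrime)
    (I : Ideal A) (hI : IsInvariantIdeal k A H ψ I) :
    I.radical = sInf {p : Ideal A | p.IsPrime ∧ IsInvariantIdeal k A H ψ p ∧ I ≤ p} ∧
      IsInvariantIdeal k A H ψ I.radical := by
  have key : ∀ p : Ideal A, p.IsPrime → I ≤ p →
      ∃ q : Ideal A, q.IsPrime ∧ IsInvariantIdeal k A H ψ q ∧ I ≤ q ∧ q ≤ p := by
    intro p hp hIp
    obtain ⟨q, hq, hqp⟩ := hstar p hp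
    have hm : ∀ x, x ∈ q ↔ x ∈ p ∧ ψ x ∈ idealTensor k A H p := fun x => by
      rw [← SetLike.mem_coe, hq]; rfl
    refine ⟨q, hqp, ?_, ?_, fun x hx => ((hm x).1 hx).1⟩
    · intro x hx
      have hx2 := (mem_idealTensor_iff k A H p _).1 ((hm x).1 hx).2
      rw [mem_idealTensor_iff]
      intro φ
      rw [hm, mem_idealTensor_iff]
      refine ⟨hx2 φ, fun χ => ?_⟩
      rw [slice_slice k A H ψ hco]
      exact hx2 _
    · intro x hx
      rw [hm, mem_idealTensor_iff]
      exact ⟨hIp hx, fun φ => hIp ((mem_idealTensor_iff k A H I _).1 (hI x hx) φ)⟩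
  have heq : I.radical =
      sInf {p : Ideal A | p.IsPrime ∧ IsInvariantIdeal k A H ψ p ∧ I ≤ p} := by
    apply le_antisymm
    · refine le_sInf ?_
      rintro p ⟨hp, -, hIp⟩
      exact hp.radical_le_iff.2 hIp
    · rw [Ideal.radical_eq_sInf]
      refine le_sInf ?_
      rintro p ⟨hIp, hp⟩
      obtain ⟨q, hq, hqi, hIq, hqp⟩ := key p hp hIp
      refine le_trans (sInf_le ?_) hqp
      exact ⟨hq, hqi, hIq⟩
  refine ⟨heq, ?_⟩
  rw [heq]
  intro x hx
  rw [mem_idealTensor_iff]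
  intro φ
  rw [Submodule.mem_sInf] at hx ⊢
  intro p hp
  exact (mem_idealTensor_iff k A H p _).1 (hp.2.1 x (hx p hp)) φ
end

section
/- If I is a finitely generated ideal of A, then the smallest invariant ideal I♯ containing I is finitely generated. -/
open TensorProduct

variable (k : Type*) [Field k]
variable (A : Type*) [CommRing A] [Algebra k A]
variable (H : Type*) [Ring H] [HopfAlgebra k H]

/-- `I♯`: the intersection of all invariant ideals of `A` containing `I`
(the smallest invariant ideal containing `I`). -/
noncomputable def sharpIdeal (ψ : A →ₐ[k] A ⊗[k] H) (I : Ideal A) : Ideal A :=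
  sInf {J : Ideal A | IsInvariantIdeal k A H ψ J ∧ I ≤ J}


/-- Slice map `(id ⊗ f)`. -/
noncomputable def sliceMap (f : H →ₗ[k] k) : A ⊗[k] H →ₗ[k] A :=
  (TensorProduct.rid k A).toLinearMap ∘ₗ TensorProduct.map LinearMap.id f

theorem sliceMap_tmul (f : H →ₗ[k] k) (a : A) (h : H) :
    sliceMap k A H f (a ⊗ₜ h) = f h • a := by
  simp [sliceMap]

theorem slice_mem (f : H →ₗ[k] k) (J : Ideal A) (z : A ⊗[k] H)
    (hz : z ∈ idealTensor k A H J) : sliceMap k A H f z ∈ J := by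
  obtain ⟨w, rfl⟩ := hz
  induction w with
  | zero => simp
  | add x y hx hy => rw [map_add, map_add]; exact J.add_mem hx hy
  | tmul a h =>
    rw [TensorProduct.map_tmul, sliceMap_tmul]
    exact (J.restrictScalars k).smul_mem _ a.2

theorem exists_finite_slices (z : A ⊗[k] H) :
    ∃ (T : Finset H) (φ : H → (H →ₗ[k] k)),
      z = ∑ t ∈ T, sliceMap k A H (φ t) z ⊗ₜ[k] t := by
  classical
  let b := Module.Basis.ofVectorSpace k H
  obtain ⟨c, hc⟩ := TensorProduct.eq_repr_basis_right b z
  have hs : ∀ j, sliceMap k A H (b.coord j) z = c j := by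
    intro j
    rw [← hc, Finsupp.sum, map_sum]
    simp only [sliceMap_tmul, Module.Basis.coord_apply, Module.Basis.repr_self]
    rw [Finset.sum_eq_single j]
    · simp
    · intro i _ hij
      simp [Finsupp.single_apply, hij]
    · intro hj
      simpa using hj
  have hinj : Function.Injective b := b.injective
  refine ⟨c.support.image b, fun h => if hh : ∃ j, b j = h then b.coord hh.choose else 0, ?_⟩
  rw [Finset.sum_image (fun x _ y _ h => hinj h)]
  have : ∀ j, (if hh : ∃ i, b i = b j then b.coord hh.choose else 0) = b.coord j := by
    intro j
    have hh : ∃ i, b i = b j := ⟨j, rfl⟩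
    rw [dif_pos hh, hinj hh.choose_spec]
  simp only [this, hs]
  exact hc.symm

theorem mem_idealTensor_of_slice (J : Ideal A) (z : A ⊗[k] H)
    (hz : ∀ f, sliceMap k A H f z ∈ J) : z ∈ idealTensor k A H J := by
  obtain ⟨T, φ, h⟩ := exists_finite_slices k A H z
  rw [h]
  refine Submodule.sum_mem _ fun t _ => ?_
  exact ⟨(⟨_, hz (φ t)⟩ : J.restrictScalars k) ⊗ₜ t, by simp⟩

theorem slice_mul (f : H →ₗ[k] k) (a : A) (h : H) (z : A ⊗[k] H) :
    sliceMap k A H f ((a ⊗ₜ h) * z) = a * sliceMap k A H (f ∘ₗ LinearMap.mulLeft k h) z := by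
  induction z with
  | zero => simp
  | add x y hx hy => rw [mul_add, map_add, map_add, hx, hy, mul_add]
  | tmul b g => simp [sliceMap_tmul]

theorem mul_mem_idealTensor (J : Ideal A) (u z : A ⊗[k] H)
    (hz : z ∈ idealTensor k A H J) : u * z ∈ idealTensor k A H J := by
  induction u with
  | zero => simp
  | add x y hx hy => rw [add_mul]; exact Submodule.add_mem _ hx hy
  | tmul a h =>
    refine mem_idealTensor_of_slice k A H J _ fun f => ?_
    rw [slice_mul]
    exact J.mul_mem_left _ (slice_mem k A H _ J z hz)

/-- Convolution-type functional. -/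
noncomputable def convFun (g f : H →ₗ[k] k) : H →ₗ[k] k :=
  (TensorProduct.lid k k).toLinearMap ∘ₗ TensorProduct.map g f ∘ₗ Coalgebra.comul

theorem slice_slice_s9 (ψ : A →ₐ[k] A ⊗[k] H) (hco : IsCoassoc k A H ψ)
    (g f : H →ₗ[k] k) (x : A) :
    sliceMap k A H g (ψ (sliceMap k A H f (ψ x))) = sliceMap k A H (convFun k H g f) (ψ x) := by
  let L : A ⊗[k] (H ⊗[k] H) →ₗ[k] A :=
    (TensorProduct.rid k A).toLinearMap ∘ₗ TensorProduct.map LinearMap.id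
      ((TensorProduct.lid k k).toLinearMap ∘ₗ TensorProduct.map g f)
  have h1 : ∀ z : A ⊗[k] H, sliceMap k A H g (ψ (sliceMap k A H f z)) =
      L (TensorProduct.assoc k A H H
        (TensorProduct.map ψ.toLinearMap (LinearMap.id : H →ₗ[k] H) z)) := by
    intro z
    induction z with
    | zero => simp
    | add x y hx hy => simp only [map_add, hx, hy]
    | tmul a h =>
      rw [sliceMap_tmul, map_smul, map_smul, TensorProduct.map_tmul]
      simp only [AlgHom.toLinearMap_apply, LinearMap.id_apply]
      induction ψ a with
      | zero => simp
      | add x y hx hy => rw [map_add, smul_add, hx, hy, TensorProduct.add_tmul, map_add, map_add]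
      | tmul b l =>
        simp [L, sliceMap_tmul, smul_smul, mul_comm]
  have h2 : ∀ z : A ⊗[k] H, sliceMap k A H (convFun k H g f) z =
      L (TensorProduct.map (LinearMap.id : A →ₗ[k] A)
          (Coalgebra.comul (R := k) (A := H)) z) := by
    intro z
    induction z with
    | zero => simp
    | add x y hx hy => simp only [map_add, hx, hy]
    | tmul a h => simp [L, sliceMap_tmul, convFun]
  rw [h1, h2, hco]

/-- if `I` is finitely generated, then `I♯` is finitely generated. -/
theorem stmt9 (ψ : A →ₐ[k] A ⊗[k] H)
    (hco : IsCoassoc k A H ψ) (hcu : IsCounital k A H ψ)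
    (I : Ideal A) (hfg : I.FG) :
    (sharpIdeal k A H ψ I).FG := by
  classical
  obtain ⟨S, rfl⟩ := hfg
  let J : Ideal A := Ideal.span {y | ∃ x ∈ S, ∃ f, y = sliceMap k A H f (ψ x)}
  have hgen : ∀ x ∈ S, ∀ f, sliceMap k A H f (ψ x) ∈ J := fun x hx f =>
    Ideal.subset_span ⟨x, hx, f, rfl⟩
  have hJinv : IsInvariantIdeal k A H ψ J := by
    intro y hy
    induction hy using Submodule.span_induction with
    | mem y hy =>
      obtain ⟨x, hx, f, rfl⟩ := hy
      refine mem_idealTensor_of_slice k A H J _ fun g => ?_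
      rw [slice_slice_s9 k A H ψ hco]
      exact hgen x hx _
    | zero => simp
    | add a b _ _ ha hb => rw [map_add]; exact Submodule.add_mem _ ha hb
    | smul a b _ hb =>
      rw [smul_eq_mul, map_mul]
      exact mul_mem_idealTensor k A H J _ _ hb
  have hIJ : Ideal.span (S : Set A) ≤ J := by
    refine Ideal.span_le.2 fun x hx => ?_
    have := hgen x hx Coalgebra.counit
    have h2 : sliceMap k A H Coalgebra.counit (ψ x) = x := hcu x
    rwa [h2] at this
  have hJ : sharpIdeal k A H ψ (Ideal.span (S : Set A)) = J := by
    apply le_antisymm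
    · exact sInf_le ⟨hJinv, hIJ⟩
    · refine le_sInf fun K hK => Ideal.span_le.2 ?_
      rintro _ ⟨x, hx, f, rfl⟩
      exact slice_mem k A H f K _ (hK.1 x (hK.2 (Ideal.subset_span hx)))
  rw [hJ]
  choose T φ hT using fun x : A => exists_finite_slices k A H (ψ x)
  refine ⟨S.biUnion fun x => (T x).image fun t => sliceMap k A H (φ x t) (ψ x), ?_⟩
  apply le_antisymm
  · refine Ideal.span_le.2 fun y hy => ?_
    simp only [Finset.coe_biUnion, Finset.coe_image, Set.mem_iUnion, Set.mem_image] at hy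
    obtain ⟨x, hx, t, _, rfl⟩ := hy
    exact hgen x hx _
  · refine Ideal.span_le.2 ?_
    rintro _ ⟨x, hx, f, rfl⟩
    rw [hT x, map_sum]
    refine Submodule.sum_mem _ fun t ht => ?_
    rw [sliceMap_tmul]
    refine Submodule.smul_of_tower_mem _ _ (Ideal.subset_span ?_)
    simp only [Finset.coe_biUnion, Finset.coe_image, Set.mem_iUnion, Set.mem_image]
    exact ⟨x, hx, t, ht, rfl⟩
end

section
/- Assume that for every prime ideal p of A, the largest invariant ideal p* = {x ∈ p : ψ(x) ∈ p ⊗ H} contained in p is again a prime ideal. Then an open subset U of Spec^inv(A) is quasi-compact if and only if U = Spec^inv(A) \ V^inv(I) for some finitely generated invariant ideal I of A. -/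
open TensorProduct

variable (k : Type*) [Field k]
variable (A : Type*) [CommRing A] [Algebra k A]
variable (H : Type*) [Ring H] [HopfAlgebra k H]

namespace InvSpec

/-- Evaluation of the second tensor factor at a functional. -/
noncomputable def ev (φ : H →ₗ[k] k) : A ⊗[k] H →ₗ[k] A :=
  (TensorProduct.rid k A).toLinearMap ∘ₗ TensorProduct.map (LinearMap.id : A →ₗ[k] A) φ

theorem ev_tmul (φ : H →ₗ[k] k) (a : A) (h : H) : ev k A H φ (a ⊗ₜ h) = φ h • a := by
  simp [ev]

/-- A basis of `A ⊗ H` over `A`. -/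
noncomputable def bas : Module.Basis (Module.Free.ChooseBasisIndex k H) A (A ⊗[k] H) :=
  Algebra.TensorProduct.basis A (Module.Free.chooseBasis k H)

theorem repr_eq_ev (z : A ⊗[k] H) (i) :
    (bas k A H).repr z i = ev k A H ((Module.Free.chooseBasis k H).coord i) z := by
  induction z using TensorProduct.induction_on with
  | zero => simp
  | add x y hx hy => simp [hx, hy]
  | tmul a h =>
    rw [ev_tmul, bas, Algebra.TensorProduct.basis_repr_tmul]
    simp [Algebra.smul_def, mul_comm]

theorem tmul_mem {I : Ideal A} {a : A} (ha : a ∈ I) (h : H) :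
    a ⊗ₜ h ∈ idealTensor k A H I :=
  ⟨(⟨a, ha⟩ : I.restrictScalars k) ⊗ₜ h, by simp⟩

theorem ev_mem {I : Ideal A} {z : A ⊗[k] H} (hz : z ∈ idealTensor k A H I) (φ : H →ₗ[k] k) :
    ev k A H φ z ∈ I := by
  obtain ⟨t, rfl⟩ := hz
  induction t using TensorProduct.induction_on with
  | zero => simp
  | add x y hx hy => rw [map_add, map_add]; exact I.add_mem hx hy
  | tmul a h =>
    rw [TensorProduct.map_tmul, ev_tmul]
    exact (I.restrictScalars k).smul_mem _ a.2

theorem mem_of_repr {I : Ideal A} {z : A ⊗[k] H} (hz : ∀ i, (bas k A H).repr z i ∈ I) :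
    z ∈ idealTensor k A H I := by
  rw [← (bas k A H).linearCombination_repr z, Finsupp.linearCombination_apply, Finsupp.sum]
  refine Submodule.sum_mem _ fun i _ => ?_
  have : (bas k A H) i = 1 ⊗ₜ (Module.Free.chooseBasis k H) i := by simp [bas]
  rw [this, TensorProduct.smul_tmul', smul_eq_mul, mul_one]
  exact tmul_mem k A H (hz i) _

theorem mem_iff_repr {I : Ideal A} {z : A ⊗[k] H} :
    z ∈ idealTensor k A H I ↔ ∀ i, (bas k A H).repr z i ∈ I :=
  ⟨fun h i => by rw [repr_eq_ev]; exact ev_mem k A H h _, mem_of_repr k A H⟩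

theorem mul_mem {I : Ideal A} (w : A ⊗[k] H) {z : A ⊗[k] H} (hz : z ∈ idealTensor k A H I) :
    w * z ∈ idealTensor k A H I := by
  obtain ⟨t, rfl⟩ := hz
  induction t using TensorProduct.induction_on with
  | zero => simp
  | add x y hx hy => rw [map_add, mul_add]; exact Submodule.add_mem _ hx hy
  | tmul a h =>
    rw [TensorProduct.map_tmul]
    induction w using TensorProduct.induction_on with
    | zero => simp
    | add x y hx hy => rw [add_mul]; exact Submodule.add_mem _ hx hy
    | tmul b g =>
      rw [Algebra.TensorProduct.tmul_mul_tmul]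
      exact tmul_mem k A H (I.mul_mem_left _ a.2) _

variable {k A H}

theorem ev_ev {ψ : A →ₐ[k] A ⊗[k] H} (hco : IsCoassoc k A H ψ) (φ χ : H →ₗ[k] k) (f : A) :
    ev k A H φ (ψ (ev k A H χ (ψ f))) =
      ev k A H ((TensorProduct.lid k k).toLinearMap ∘ₗ TensorProduct.map φ χ ∘ₗ
        Coalgebra.comul) (ψ f) := by
  let L : A ⊗[k] (H ⊗[k] H) →ₗ[k] A := (TensorProduct.rid k A).toLinearMap ∘ₗ
    TensorProduct.map (LinearMap.id : A →ₗ[k] A)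
      ((TensorProduct.lid k k).toLinearMap ∘ₗ TensorProduct.map φ χ)
  have h := congrArg L (hco f)
  have h1 : ∀ z : A ⊗[k] H, L ((TensorProduct.assoc k A H H)
      ((TensorProduct.map ψ.toLinearMap (LinearMap.id : H →ₗ[k] H)) z)) =
      ev k A H φ (ψ (ev k A H χ z)) := by
    intro z
    induction z using TensorProduct.induction_on with
    | zero => simp
    | add x y hx hy => simp only [map_add, hx, hy]
    | tmul a h =>
      rw [ev_tmul, TensorProduct.map_tmul, map_smul, map_smul]
      simp only [AlgHom.toLinearMap_apply, LinearMap.id_apply]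
      generalize ψ a = w
      induction w using TensorProduct.induction_on with
      | zero => simp
      | add x y hx hy => simp only [map_add, smul_add, TensorProduct.add_tmul, hx, hy]
      | tmul b g =>
        simp [L, ev_tmul, smul_smul, mul_comm]
  have h2 : ∀ z : A ⊗[k] H, L ((TensorProduct.map (LinearMap.id : A →ₗ[k] A)
          (Coalgebra.comul (R := k) (A := H))) z) =
      ev k A H ((TensorProduct.lid k k).toLinearMap ∘ₗ TensorProduct.map φ χ ∘ₗ
        Coalgebra.comul) z := by
    intro z
    induction z using TensorProduct.induction_on with
    | zero => simp
    | add x y hx hy => simp only [map_add, hx, hy]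
    | tmul a h => simp [L, ev_tmul]
  rw [h1, h2] at h
  exact h

/-- Coefficients of `ψ f` again have `ψ` in `I ⊗ H`. -/
theorem coeff_mem {ψ : A →ₐ[k] A ⊗[k] H} (hco : IsCoassoc k A H ψ) {I : Ideal A} {f : A}
    (hf : ψ f ∈ idealTensor k A H I) (i) :
    ψ ((bas k A H).repr (ψ f) i) ∈ idealTensor k A H I := by
  rw [mem_iff_repr]
  intro j
  rw [repr_eq_ev, repr_eq_ev, ev_ev hco]
  exact ev_mem k A H hf _

theorem self_mem {ψ : A →ₐ[k] A ⊗[k] H} (hcu : IsCounital k A H ψ) {I : Ideal A} {f : A}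
    (hf : ψ f ∈ idealTensor k A H I) : f ∈ I := by
  have := ev_mem k A H hf Coalgebra.counit
  rwa [show ev k A H Coalgebra.counit (ψ f) = f from hcu f] at this

theorem span_inv {ψ : A →ₐ[k] A ⊗[k] H} {S : Set A}
    (hS : ∀ s ∈ S, ψ s ∈ idealTensor k A H (Ideal.span S)) :
    IsInvariantIdeal k A H ψ (Ideal.span S) := by
  intro x hx
  induction hx using Submodule.span_induction with
  | mem x h => exact hS x h
  | zero => simp
  | add x y _ _ hx hy => rw [map_add]; exact Submodule.add_mem _ hx hy
  | smul a x _ hx => rw [smul_eq_mul, map_mul]; exact mul_mem k A H _ hx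

theorem repr_range_finite (z : A ⊗[k] H) : (Set.range fun i => (bas k A H).repr z i).Finite :=
  Finsupp.finite_range _

theorem star_inv {ψ : A →ₐ[k] A ⊗[k] H} (hco : IsCoassoc k A H ψ) {p q : Ideal A}
    (hq : (q : Set A) = starSet k A H ψ p) : IsInvariantIdeal k A H ψ q := by
  have hq' : ∀ x, x ∈ q ↔ x ∈ p ∧ ψ x ∈ idealTensor k A H p := fun x => by
    rw [← SetLike.mem_coe, hq]; rfl
  intro x hx
  rw [hq'] at hx
  rw [mem_iff_repr]
  intro i
  rw [hq']
  exact ⟨(mem_iff_repr k A H).1 hx.2 i, coeff_mem hco hx.2 i⟩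

end InvSpec

open InvSpec

/-- assuming `p*` is prime for every prime `p`, an open subset `U` of
`Spec^inv(A)` is quasi-compact iff `U = Spec^inv(A) \ V^inv(I)` for some finitely
generated invariant ideal `I`. -/
theorem stmt11 (ψ : A →ₐ[k] A ⊗[k] H)
    (hco : IsCoassoc k A H ψ) (hcu : IsCounital k A H ψ)
    (hstar : ∀ p : Ideal A, p.IsPrime →
      ∃ q : Ideal A, (q : Set A) = starSet k A H ψ p ∧ q.IsPrime)
    (U : Set {q : PrimeSpectrum A // IsInvariantIdeal k A H ψ q.asIdeal})
    (hU : IsOpen U) :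
    IsCompact U ↔ ∃ I : Ideal A, I.FG ∧ IsInvariantIdeal k A H ψ I ∧
      U = {p : {q : PrimeSpectrum A // IsInvariantIdeal k A H ψ q.asIdeal} |
            I ≤ p.1.asIdeal}ᶜ := by
  constructor
  · intro hc
    obtain ⟨V, hV, rfl⟩ := isOpen_induced_iff.1 hU
    obtain ⟨S, hS⟩ := (PrimeSpectrum.isOpen_iff V).1 hV
    have hmem : ∀ p : PrimeSpectrum A, p ∈ V ↔ ∃ f ∈ S, f ∉ p.asIdeal := by
      intro p
      rw [← not_iff_not, ← Set.mem_compl_iff, hS, PrimeSpectrum.mem_zeroLocus, Set.subset_def]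
      push Not
      rfl
    obtain ⟨T, hT⟩ := hc.elim_finite_subcover
      (fun f : S => {p : {q : PrimeSpectrum A // IsInvariantIdeal k A H ψ q.asIdeal} |
        (f : A) ∉ p.1.asIdeal})
      (fun f => (PrimeSpectrum.basicOpen (f : A)).isOpen.preimage continuous_subtype_val)
      (by
        intro p hp
        obtain ⟨f, hf, hfp⟩ := (hmem p.1).1 hp
        exact Set.mem_iUnion.2 ⟨⟨f, hf⟩, hfp⟩)
    let G : Set A := ⋃ f ∈ T, Set.range fun i => (bas k A H).repr (ψ (f : A)) i
    have hG : ∀ f ∈ T, ψ (f : A) ∈ idealTensor k A H (Ideal.span G) := by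
      intro f hf
      rw [mem_iff_repr]
      intro i
      exact Ideal.subset_span (Set.mem_biUnion hf ⟨i, rfl⟩)
    refine ⟨Ideal.span G, Submodule.fg_span
      (T.finite_toSet.biUnion fun f _ => repr_range_finite _), span_inv ?_, ?_⟩
    · intro s hs
      obtain ⟨f, hf, i, rfl⟩ := Set.mem_iUnion₂.1 hs
      exact coeff_mem hco (hG f hf) i
    · ext p
      constructor
      · intro hp hle
        obtain ⟨f, hf, hfp⟩ := Set.mem_iUnion₂.1 (hT hp)
        exact hfp (hle (self_mem hcu (hG f hf)))
      · intro hp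
        by_contra hpV
        apply hp
        have h0 : ∀ f ∈ S, f ∈ p.1.asIdeal := by
          intro f hf
          by_contra h
          exact hpV ((hmem p.1).2 ⟨f, hf, h⟩)
        refine Ideal.span_le.2 fun s hs => ?_
        obtain ⟨f, hf, i, rfl⟩ := Set.mem_iUnion₂.1 hs
        exact (mem_iff_repr k A H).1 (p.2 _ (h0 f f.2)) i
  · rintro ⟨I, hfg, -, rfl⟩
    choose! q hq hqp using hstar
    have hq' : ∀ p : Ideal A, p.IsPrime → ∀ x, x ∈ q p ↔ ψ x ∈ idealTensor k A H p := by
      intro p hp x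
      rw [← SetLike.mem_coe, hq p hp]
      exact ⟨fun h => h.2, fun h => ⟨self_mem hcu h, h⟩⟩
    let r : PrimeSpectrum A → {q : PrimeSpectrum A // IsInvariantIdeal k A H ψ q.asIdeal} :=
      fun p => ⟨⟨q p.asIdeal, hqp _ p.2⟩, star_inv hco (hq _ p.2)⟩
    have hr : Continuous r := by
      refine Continuous.subtype_mk ?_ _
      refine PrimeSpectrum.isTopologicalBasis_basic_opens.continuous_iff.2 ?_
      rintro _ ⟨f, rfl⟩
      rw [PrimeSpectrum.isOpen_iff]
      refine ⟨Set.range fun i => (bas k A H).repr (ψ f) i, ?_⟩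
      ext p
      rw [Set.mem_compl_iff, Set.mem_preimage, SetLike.mem_coe, PrimeSpectrum.mem_basicOpen,
        not_not, PrimeSpectrum.mem_zeroLocus, Set.range_subset_iff]
      exact (hq' _ p.2 f).trans (mem_iff_repr k A H)
    obtain ⟨s, rfl⟩ := hfg
    have hc : IsCompact (PrimeSpectrum.zeroLocus (s : Set A))ᶜ :=
      PrimeSpectrum.isCompact_isOpen_iff.2 ⟨s, rfl⟩ |>.1
    convert hc.image hr using 1
    ext p
    simp only [Set.mem_compl_iff, Set.mem_setOf_eq, Set.mem_image, PrimeSpectrum.mem_zeroLocus]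
    constructor
    · intro h
      refine ⟨p.1, fun h' => h (Ideal.span_le.2 h'), ?_⟩
      apply Subtype.ext
      apply PrimeSpectrum.ext
      ext x
      exact (hq' _ p.1.2 x).trans ⟨self_mem hcu, p.2 x⟩
    · rintro ⟨p', h, rfl⟩ hle
      exact h fun x hx => self_mem hcu ((hq' _ p'.2 x).1 (hle (Ideal.subset_span hx)))
end

section
/- Assume that for every prime ideal p of A, the largest invariant ideal p* = {x ∈ p : ψ(x) ∈ p ⊗ H} contained in p is again a prime ideal. Then Spec^inv(A) is sober: every nonempty irreducible closed subset of Spec^inv(A) has a unique generic point. -/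
open TensorProduct

variable (k : Type*) [Field k]
variable (A : Type*) [CommRing A] [Algebra k A]
variable (H : Type*) [Ring H] [HopfAlgebra k H]

theorem mem_idealTensor_iff_s15 {ι : Type*} (b : Module.Basis ι k H) (I : Ideal A) (t : A ⊗[k] H) :
    t ∈ idealTensor k A H I ↔ ∀ i, (b.baseChange A).repr t i ∈ I := by
  constructor
  · rintro ⟨u, rfl⟩ i
    induction u using TensorProduct.induction_on with
    | zero => simp
    | tmul x h =>
      simp only [TensorProduct.map_tmul, Module.Basis.baseChange_repr_tmul]
      exact (I.restrictScalars k).smul_mem _ x.2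
    | add x y hx hy =>
      simp only [map_add, Finsupp.add_apply]
      exact I.add_mem hx hy
  · intro h
    rw [← (b.baseChange A).linearCombination_repr t, Finsupp.linearCombination_apply,
      Finsupp.sum]
    refine Submodule.sum_mem _ fun i _ => ?_
    refine ⟨(⟨(b.baseChange A).repr t i, h i⟩ : I.restrictScalars k) ⊗ₜ[k] b i, ?_⟩
    simp [Module.Basis.baseChange_apply, TensorProduct.smul_tmul']

/-- assuming `p*` is prime for every prime `p`, `Spec^inv(A)` is sober:
every nonempty irreducible closed subset has a unique generic point. -/
theorem stmt15 (ψ : A →ₐ[k] A ⊗[k] H)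
    (hco : IsCoassoc k A H ψ) (hcu : IsCounital k A H ψ)
    (hstar : ∀ p : Ideal A, p.IsPrime →
      ∃ q : Ideal A, (q : Set A) = starSet k A H ψ p ∧ q.IsPrime)
    (Z : Set {q : PrimeSpectrum A // IsInvariantIdeal k A H ψ q.asIdeal})
    (hirr : IsIrreducible Z) (hcl : IsClosed Z) :
    ∃! p : {q : PrimeSpectrum A // IsInvariantIdeal k A H ψ q.asIdeal},
      closure {p} = Z := by
  have hind : Topology.IsInducing (Subtype.val :
      {q : PrimeSpectrum A // IsInvariantIdeal k A H ψ q.asIdeal} → PrimeSpectrum A) :=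
    Topology.IsInducing.subtypeVal
  have hprime : (PrimeSpectrum.vanishingIdeal (Subtype.val '' Z)).IsPrime :=
    PrimeSpectrum.isIrreducible_iff_vanishingIdeal_isPrime.mp
      (hirr.image _ hind.continuous.continuousOn)
  have hinv : IsInvariantIdeal k A H ψ (PrimeSpectrum.vanishingIdeal (Subtype.val '' Z)) := by
    intro x hx
    rw [mem_idealTensor_iff_s15 k A H (Module.Basis.ofVectorSpace k H)]
    intro i
    rw [PrimeSpectrum.mem_vanishingIdeal] at hx ⊢
    intro p hp
    have h1 := hx p hp
    obtain ⟨q, hq, rfl⟩ := hp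
    exact (mem_idealTensor_iff_s15 k A H (Module.Basis.ofVectorSpace k H) _ _).mp (q.2 x h1) i
  refine ⟨⟨⟨_, hprime⟩, hinv⟩, ?_, ?_⟩
  · change closure _ = Z
    rw [hind.closure_eq_preimage_closure_image, Set.image_singleton, PrimeSpectrum.closure_singleton]
    conv_rhs => rw [← hcl.closure_eq, hind.closure_eq_preimage_closure_image,
      ← PrimeSpectrum.zeroLocus_vanishingIdeal_eq_closure]
  · intro y hy
    have key : closure {(⟨⟨_, hprime⟩, hinv⟩ :
        {q : PrimeSpectrum A // IsInvariantIdeal k A H ψ q.asIdeal})} = Z := by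
      rw [hind.closure_eq_preimage_closure_image, Set.image_singleton,
        PrimeSpectrum.closure_singleton]
      conv_rhs => rw [← hcl.closure_eq, hind.closure_eq_preimage_closure_image,
        ← PrimeSpectrum.zeroLocus_vanishingIdeal_eq_closure]
    exact (inseparable_iff_closure_eq.mpr (hy.trans key.symm)).eq
end
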